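/- arXiv:2212.06280 — 2 statements merged into one kernel-verified Lean document; each statement's English description precedes it below -/
import Mathlib

section
/- Let G∞, G_f be groups, G = G∞ × G_f with first projection π∞, Γ ≤ G a subgroup, K∞ ≤ G∞ and U_f ≤ G_f subgroups, and U = K∞ × U_f. Let T = T∞ × T_f ≤ G be an abelian subgroup with T∞ ≤ G∞, T_f ≤ G_f, and let g = (g∞, g_f) ∈ G satisfy T∞ = g∞ K∞ g∞⁻¹. Assume that every γ ∈ Γ with π∞(γ) ∈ T∞ lies in T. Let s = (1, s_f) ∈ T be an element with trivial first component. Then the assignment t ↦ (Γ×Γ)(t g, t s g)(U×U) induces a well-defined bijection from (Γ ∩ T)\T/(T ∩ gUg⁻¹) onto the joint packet {(Γ×Γ)(t g, t s g)(U×U) : t ∈ T} inside (Γ×Γ)\(G×G)/(U×U). -/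
/-- The double coset `H x K` of `x` with respect to two subsets `H, K` of a group. -/
def doubleCoset {G : Type*} [Group G] (H K : Set G) (x : G) : Set G :=
  {y | ∃ h ∈ H, ∃ k ∈ K, y = h * x * k}

/-- Two double cosets of a pair of subgroups agree iff their representatives are related. -/
theorem doubleCoset_eq_iff {G : Type*} [Group G] (H K : Subgroup G) (x y : G) :
    doubleCoset (H : Set G) (K : Set G) x = doubleCoset (H : Set G) (K : Set G) y ↔
      ∃ h ∈ H, ∃ k ∈ K, x = h * y * k := by
  constructor
  · intro h
    have hx : x ∈ doubleCoset (H : Set G) (K : Set G) x :=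
      ⟨1, H.one_mem, 1, K.one_mem, by simp⟩
    rw [h] at hx
    exact hx
  · rintro ⟨h, hh, k, hk, rfl⟩
    ext z
    constructor
    · rintro ⟨a, ha, b, hb, rfl⟩
      exact ⟨a * h, H.mul_mem ha hh, k * b, K.mul_mem hk hb, by group⟩
    · rintro ⟨a, ha, b, hb, rfl⟩
      exact ⟨a * h⁻¹, H.mul_mem ha (H.inv_mem hh), k⁻¹ * b, K.mul_mem (K.inv_mem hk) hb,
        by group⟩

/-- Two functions with the same fibres on the set cut out by `p` have equivalent images. -/
theorem exists_equiv_image_of_eq_iff {α β γ : Type*} (p : α → Prop) (f : α → β) (g : α → γ)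
    (h : ∀ a, p a → ∀ b, p b → (f a = f b ↔ g a = g b)) :
    ∃ e : {x : β // ∃ a, p a ∧ x = f a} ≃ {y : γ // ∃ a, p a ∧ y = g a},
      ∀ a (ha : p a), (e ⟨f a, a, ha, rfl⟩ : γ) = g a := by
  choose r hr using fun x : {x : β // ∃ a, p a ∧ x = f a} => x.2
  refine ⟨Equiv.ofBijective (fun x => ⟨g (r x), r x, (hr x).1, rfl⟩) ⟨?_, ?_⟩, ?_⟩
  · intro x y hxy
    apply Subtype.ext
    rw [(hr x).2, (hr y).2]
    exact (h _ (hr x).1 _ (hr y).1).2 (congrArg Subtype.val hxy)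
  · rintro ⟨_, a, ha, rfl⟩
    exact ⟨⟨f a, a, ha, rfl⟩, Subtype.ext ((h _ (hr _).1 _ ha).1 (hr _).2.symm)⟩
  · intro a ha
    exact (h _ (hr _).1 _ ha).1 (hr ⟨f a, a, ha, rfl⟩).2.symm

/-- With `G = G∞ × G_f`, `Γ ≤ G`, `U = K∞ × U_f`, `T = T∞ × T_f`
abelian, `g = (g∞, g_f)` with `T∞ = g∞ K∞ g∞⁻¹`, the rationality assumption on `Γ`,
and a shift `s = (1, s_f) ∈ T`, the map `t ↦ (Γ×Γ)(tg, tsg)(U×U)` induces a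
bijection from `(Γ ∩ T)\T/(T ∩ gUg⁻¹)` onto the joint Heegner packet
`{(Γ×Γ)(tg, tsg)(U×U) : t ∈ T}` inside `(Γ×Γ)\(G×G)/(U×U)`. -/
theorem joint_heegner_packet_bijection
    {Ginf Gf : Type*} [Group Ginf] [Group Gf]
    (Γ : Subgroup (Ginf × Gf)) (Kinf : Subgroup Ginf) (Uf : Subgroup Gf)
    (Tinf : Subgroup Ginf) (Tf : Subgroup Gf)
    (ginf : Ginf) (gf : Gf) (sf : Gf)
    (hconj : (Tinf : Set Ginf) = (fun k => ginf * k * ginf⁻¹) '' (Kinf : Set Ginf))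
    (hrat : ∀ γ ∈ Γ, γ.1 ∈ Tinf → γ ∈ Tinf.prod Tf)
    (habelian : ∀ a ∈ Tinf.prod Tf, ∀ b ∈ Tinf.prod Tf, a * b = b * a)
    (hs : ((1 : Ginf), sf) ∈ Tinf.prod Tf) :
    ∃ e : {S : Set (Ginf × Gf) // ∃ t ∈ Tinf.prod Tf,
            S = doubleCoset ((Γ : Set (Ginf × Gf)) ∩ (Tinf.prod Tf : Set (Ginf × Gf)))
                  ((Tinf.prod Tf : Set (Ginf × Gf)) ∩
                    ((fun u => (ginf, gf) * u * (ginf, gf)⁻¹) ''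
                      ((Kinf.prod Uf : Subgroup (Ginf × Gf)) : Set (Ginf × Gf)))) t} ≃
         {S : Set ((Ginf × Gf) × (Ginf × Gf)) // ∃ t ∈ Tinf.prod Tf,
            S = doubleCoset ((Γ.prod Γ : Subgroup ((Ginf × Gf) × (Ginf × Gf))) :
                    Set ((Ginf × Gf) × (Ginf × Gf)))
                  (((Kinf.prod Uf).prod (Kinf.prod Uf) : Subgroup ((Ginf × Gf) × (Ginf × Gf))) :
                    Set ((Ginf × Gf) × (Ginf × Gf)))
                  (t * (ginf, gf), t * ((1 : Ginf), sf) * (ginf, gf))},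
      ∀ t (ht : t ∈ Tinf.prod Tf),
        (e ⟨doubleCoset ((Γ : Set (Ginf × Gf)) ∩ (Tinf.prod Tf : Set (Ginf × Gf)))
              ((Tinf.prod Tf : Set (Ginf × Gf)) ∩
                ((fun u => (ginf, gf) * u * (ginf, gf)⁻¹) ''
                  ((Kinf.prod Uf : Subgroup (Ginf × Gf)) : Set (Ginf × Gf)))) t,
            ⟨t, ht, rfl⟩⟩ : Set ((Ginf × Gf) × (Ginf × Gf)))
          = doubleCoset ((Γ.prod Γ : Subgroup ((Ginf × Gf) × (Ginf × Gf))) :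
                Set ((Ginf × Gf) × (Ginf × Gf)))
              (((Kinf.prod Uf).prod (Kinf.prod Uf) : Subgroup ((Ginf × Gf) × (Ginf × Gf))) :
                Set ((Ginf × Gf) × (Ginf × Gf)))
              (t * (ginf, gf), t * ((1 : Ginf), sf) * (ginf, gf)) := by
  refine exists_equiv_image_of_eq_iff (fun t => t ∈ Tinf.prod Tf) _ _ fun t ht t' ht' => ?_
  have hset : (fun u => (ginf, gf) * u * (ginf, gf)⁻¹) ''
      ((Kinf.prod Uf : Subgroup (Ginf × Gf)) : Set (Ginf × Gf)) =
      ((Kinf.prod Uf).map (MulAut.conj (ginf, gf)).toMonoidHom : Subgroup (Ginf × Gf)) := rfl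
  rw [hset, ← Subgroup.coe_inf, ← Subgroup.coe_inf, doubleCoset_eq_iff, doubleCoset_eq_iff]
  constructor
  · rintro ⟨γ, hγ, k, ⟨hkT, u, hu, rfl⟩, rfl⟩
    have hcomm := habelian _ hkT _ hs
    simp only [MulEquiv.coe_toMonoidHom, MulAut.conj_apply] at hcomm ⊢
    refine ⟨(γ, γ), ⟨hγ.1, hγ.1⟩, (u, u), ⟨hu, hu⟩, Prod.ext ?_ ?_⟩
    · simp only [Prod.mk_mul_mk]
      group
    · change γ * t' * ((ginf, gf) * u * (ginf, gf)⁻¹) * (1, sf) * (ginf, gf) =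
        γ * (t' * (1, sf) * (ginf, gf)) * u
      rw [mul_assoc (γ * t'), hcomm]
      group
  · rintro ⟨⟨γ, δ⟩, ⟨hγ, -⟩, ⟨u, v⟩, ⟨hu, -⟩, heq⟩
    have h1 : t * (ginf, gf) = γ * (t' * (ginf, gf)) * u := congrArg Prod.fst heq
    have hconj_mem : ginf * u.1 * ginf⁻¹ ∈ Tinf := by
      rw [← SetLike.mem_coe, hconj]
      exact ⟨u.1, hu.1, rfl⟩
    have ht_eq : t = γ * t' * ((ginf, gf) * u * (ginf, gf)⁻¹) := by
      rw [eq_mul_inv_of_mul_eq h1]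
      group
    have hγ_inf : γ.1 = t.1 * (ginf * u.1 * ginf⁻¹)⁻¹ * t'.1⁻¹ := by
      have h2 : t.1 = γ.1 * t'.1 * (ginf * u.1 * ginf⁻¹) := congrArg Prod.fst ht_eq
      rw [h2]
      group
    have hγT : γ ∈ Tinf.prod Tf := hrat γ hγ <| hγ_inf ▸
      Tinf.mul_mem (Tinf.mul_mem ht.1 (Tinf.inv_mem hconj_mem)) (Tinf.inv_mem ht'.1)
    refine ⟨γ, ⟨hγ, hγT⟩, (ginf, gf) * u * (ginf, gf)⁻¹, ⟨?_, u, hu, rfl⟩, ht_eq⟩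
    have hk : (ginf, gf) * u * (ginf, gf)⁻¹ = (γ * t')⁻¹ * t := eq_inv_mul_of_mul_eq ht_eq.symm
    rw [hk]
    exact (Tinf.prod Tf).mul_mem ((Tinf.prod Tf).inv_mem ((Tinf.prod Tf).mul_mem hγT ht')) ht
end

section
/- Let G∞, G_f be groups, G = G∞ × G_f with first projection π∞, Γ ≤ G a subgroup, K∞ ≤ G∞ and U_f ≤ G_f subgroups, and U = K∞ × U_f. Let h = (1, h_f) ∈ {1} × G_f and U(h) = U ∩ hUh⁻¹, and define β_U : Γ\G/U(h) → (Γ×Γ)\(G×G)/(U×U) by β_U(Γ g U(h)) = (Γ×Γ)(g, gh)(U×U). If β_U(Γ g U(h)) = β_U(Γ g' U(h)) but Γ g U(h) ≠ Γ g' U(h), then there exist γ ∈ Γ with γ ≠ 1 and u, u' ∈ U such that g⁻¹ γ g = u · h u' h⁻¹; in particular π∞(γ) ∈ π∞(g) K∞ π∞(g)⁻¹. -/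
theorem mem_doubleCoset_self {G : Type*} [Group G] (H K : Subgroup G) (x : G) :
    x ∈ doubleCoset (H : Set G) (K : Set G) x :=
  ⟨1, H.one_mem, 1, K.one_mem, by simp⟩

theorem doubleCoset_mul_mul {G : Type*} [Group G] (H K : Subgroup G) {a k : G}
    (ha : a ∈ H) (hk : k ∈ K) (x : G) :
    doubleCoset (H : Set G) (K : Set G) (a * x * k) = doubleCoset (H : Set G) (K : Set G) x := by
  ext y
  constructor
  · rintro ⟨b, hb, l, hl, rfl⟩
    exact ⟨b * a, H.mul_mem hb ha, k * l, K.mul_mem hk hl, by group⟩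
  · rintro ⟨b, hb, l, hl, rfl⟩
    exact ⟨b * a⁻¹, H.mul_mem hb (H.inv_mem ha), k⁻¹ * l, K.mul_mem (K.inv_mem hk) hl, by group⟩

/-- A collision of the graph of the Hecke correspondence of `h` produces a nontrivial element of
`Γ` which `g` conjugates into `U * (h * U * h⁻¹)`. -/
theorem exists_ne_one_conj_eq_of_doubleCoset_eq {G : Type*} [Group G] (Γ U : Subgroup G)
    (h g g' : G)
    (hcollide : doubleCoset (Γ.prod Γ : Set (G × G)) (U.prod U : Set (G × G)) (g, g * h) =
      doubleCoset (Γ.prod Γ : Set (G × G)) (U.prod U : Set (G × G)) (g', g' * h))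
    (hne : doubleCoset (Γ : Set G) ((U : Set G) ∩ (fun u => h * u * h⁻¹) '' (U : Set G)) g ≠
      doubleCoset (Γ : Set G) ((U : Set G) ∩ (fun u => h * u * h⁻¹) '' (U : Set G)) g') :
    ∃ γ ∈ Γ, γ ≠ 1 ∧ ∃ u ∈ U, ∃ u' ∈ U, g⁻¹ * γ * g = u * (h * u' * h⁻¹) := by
  obtain ⟨⟨a, b⟩, ⟨ha, hb⟩, ⟨k, l⟩, ⟨hk, hl⟩, hgraph⟩ :=
    hcollide ▸ mem_doubleCoset_self (Γ.prod Γ) (U.prod U) (g', g' * h)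
  obtain ⟨hg', hgh'⟩ : g' = a * g * k ∧ g' * h = b * (g * h) * l := by simpa using hgraph
  have key : g⁻¹ * (a⁻¹ * b) * g = k * (h * l⁻¹ * h⁻¹) := by
    have hb' : b = g' * h * l⁻¹ * h⁻¹ * g⁻¹ := by rw [hgh']; group
    rw [hb', hg']; group
  refine ⟨a⁻¹ * b, Γ.mul_mem (Γ.inv_mem ha) hb, fun hγ => hne ?_, k, hk, l⁻¹, U.inv_mem hl, key⟩
  have hkl : h * l * h⁻¹ = k := by
    rw [hγ] at key
    calc h * l * h⁻¹ = g⁻¹ * 1 * g * (h * l * h⁻¹) := by group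
      _ = k := by rw [key]; group
  have hcoset := doubleCoset_mul_mul Γ (U ⊓ U.map (MulAut.conj h).toMonoidHom) ha
    ⟨hk, l, hl, hkl⟩ g
  rw [← hg'] at hcoset
  exact hcoset.symm

/-- If `β_U(Γ g U(h)) = β_U(Γ g' U(h))` but `Γ g U(h) ≠ Γ g' U(h)`,
then there exist `γ ∈ Γ`, `γ ≠ 1`, and `u, u' ∈ U` with `g⁻¹ γ g = u · (h u' h⁻¹)`;
in particular the archimedean component of `γ` is conjugate into `K∞` by that of `g`. -/
theorem hecke_graph_noninjective_locus
    {Ginf Gf : Type*} [Group Ginf] [Group Gf]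
    (Γ : Subgroup (Ginf × Gf)) (Kinf : Subgroup Ginf) (Uf : Subgroup Gf)
    (hf : Gf) (g g' : Ginf × Gf)
    (hcollide :
      doubleCoset ((Γ.prod Γ : Subgroup ((Ginf × Gf) × (Ginf × Gf))) :
            Set ((Ginf × Gf) × (Ginf × Gf)))
          (((Kinf.prod Uf).prod (Kinf.prod Uf) : Subgroup ((Ginf × Gf) × (Ginf × Gf))) :
            Set ((Ginf × Gf) × (Ginf × Gf)))
          (g, g * ((1 : Ginf), hf))
        = doubleCoset ((Γ.prod Γ : Subgroup ((Ginf × Gf) × (Ginf × Gf))) :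
              Set ((Ginf × Gf) × (Ginf × Gf)))
            (((Kinf.prod Uf).prod (Kinf.prod Uf) : Subgroup ((Ginf × Gf) × (Ginf × Gf))) :
              Set ((Ginf × Gf) × (Ginf × Gf)))
            (g', g' * ((1 : Ginf), hf)))
    (hne :
      doubleCoset (Γ : Set (Ginf × Gf))
          (((Kinf.prod Uf : Subgroup (Ginf × Gf)) : Set (Ginf × Gf)) ∩
            ((fun u => ((1 : Ginf), hf) * u * ((1 : Ginf), hf)⁻¹) ''
              ((Kinf.prod Uf : Subgroup (Ginf × Gf)) : Set (Ginf × Gf)))) g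
        ≠ doubleCoset (Γ : Set (Ginf × Gf))
            (((Kinf.prod Uf : Subgroup (Ginf × Gf)) : Set (Ginf × Gf)) ∩
              ((fun u => ((1 : Ginf), hf) * u * ((1 : Ginf), hf)⁻¹) ''
                ((Kinf.prod Uf : Subgroup (Ginf × Gf)) : Set (Ginf × Gf)))) g') :
    ∃ γ ∈ Γ, γ ≠ 1 ∧
      ∃ u ∈ Kinf.prod Uf, ∃ u' ∈ Kinf.prod Uf,
        g⁻¹ * γ * g = u * (((1 : Ginf), hf) * u' * ((1 : Ginf), hf)⁻¹) ∧
        ∃ k ∈ Kinf, γ.1 = g.1 * k * g.1⁻¹ := by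
  obtain ⟨γ, hγ, hγ1, u, hu, u', hu', hconj⟩ :=
    exists_ne_one_conj_eq_of_doubleCoset_eq Γ (Kinf.prod Uf) (1, hf) g g' hcollide hne
  refine ⟨γ, hγ, hγ1, u, hu, u', hu', hconj, u.1 * u'.1, Kinf.mul_mem hu.1 hu'.1, ?_⟩
  have hfst : g.1⁻¹ * γ.1 * g.1 = u.1 * u'.1 := by simpa using congrArg Prod.fst hconj
  rw [← hfst]
  group
end
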